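/- Let L : H → B be an absolutely p-summing operator from a separable Hilbert space H to a Banach space B with p ∈ [1,2]. Then there exist a separable Hilbert space J with dim J ≤ dim H, a Hilbert–Schmidt operator j : H → J, and a continuous linear operator k : J → B such that L = k ∘ j. -/

import Mathlib

open Filter Topology
open scoped RealInnerProductSpace

/-- A measure on a topological vector space is a *centred Gaussian measure* if the pushforward
under every continuous linear functional is a centred Gaussian measure on `ℝ`. -/
def IsCentredGaussian {X : Type*} [TopologicalSpace X] [AddCommGroup X] [Module ℝ X]
    [MeasurableSpace X] (μ : MeasureTheory.Measure X) : Prop :=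
  ∀ φ : X →L[ℝ] ℝ, ∃ v : NNReal, μ.map φ = ProbabilityTheory.gaussianReal 0 v

/-- `(Y, ι)` is a Banach completion of `X` with respect to the seminorm `p`:
`ι` is isometric for `p` and has dense range.  (Completeness of `Y` is an instance
assumption at use sites.) -/
structure IsBanachCompletion {X : Type*} [AddCommGroup X] [Module ℝ X]
    {Y : Type*} [NormedAddCommGroup Y] [NormedSpace ℝ Y]
    (p : Seminorm ℝ X) (ι : X →ₗ[ℝ] Y) : Prop where
  norm_map : ∀ x, ‖ι x‖ = p x
  dense_range : DenseRange ι

/-- A linear operator between normed spaces is *absolutely `r`-summing*. -/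
def AbsolutelySumming {E F : Type*} [NormedAddCommGroup E] [NormedSpace ℝ E]
    [NormedAddCommGroup F] [NormedSpace ℝ F] (r : ℝ) (T : E →ₗ[ℝ] F) : Prop :=
  ∃ C : ℝ, 0 < C ∧ ∀ (k : ℕ) (x : Fin k → E),
    (∑ n, ‖T (x n)‖ ^ r) ^ (1 / r) ≤
      C * ⨆ φ : {ψ : E →L[ℝ] ℝ // ‖ψ‖ ≤ 1}, (∑ n, |φ.1 (x n)| ^ r) ^ (1 / r)

/-- A map between inner product spaces is *Hilbert–Schmidt* if the squared norms of the images
of some Hilbert basis are summable. -/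
def IsHilbertSchmidtMap {H J : Type*} [NormedAddCommGroup H] [InnerProductSpace ℝ H]
    [NormedAddCommGroup J] [InnerProductSpace ℝ J] (L : H → J) : Prop :=
  ∃ (ι : Type) (b : HilbertBasis ι ℝ H), Summable fun i => ‖L (b i)‖ ^ 2

/-- `(H, ι)` is (a realization of) the Cameron–Martin space of the measure `μ`:
`ι` is a continuous linear injection whose range is the set of vectors of finite
Cameron–Martin norm, and the Hilbert norm of `H` is the Cameron–Martin norm. -/
structure IsCameronMartin {X : Type*} [TopologicalSpace X] [AddCommGroup X] [Module ℝ X]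
    [MeasurableSpace X] {H : Type*} [NormedAddCommGroup H] [InnerProductSpace ℝ H]
    (μ : MeasureTheory.Measure X) (ι : H →ₗ[ℝ] X) : Prop where
  continuous : Continuous ι
  injective : Function.Injective ι
  norm_eq : ∀ h : H,
    ‖h‖ = sSup {c : ℝ | ∃ φ : X →L[ℝ] ℝ, (∫ y, (φ y) ^ 2 ∂μ) ≤ 1 ∧ c = φ (ι h)}
  range_eq : Set.range ι =
    {x : X | ∃ M : ℝ, ∀ φ : X →L[ℝ] ℝ, (∫ y, (φ y) ^ 2 ∂μ) ≤ 1 → φ x ≤ M}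

/-- A seminorm is a *Hilbert seminorm* if it is induced by a positive semidefinite symmetric
bilinear form. -/
def IsHilbertSeminorm {X : Type*} [AddCommGroup X] [Module ℝ X] (p : Seminorm ℝ X) : Prop :=
  ∃ B : X →ₗ[ℝ] X →ₗ[ℝ] ℝ, (∀ x y, B x y = B y x) ∧ (∀ x, 0 ≤ B x x) ∧
    ∀ x, p x = Real.sqrt (B x x)

/-- A continuous linear map between normed spaces is *nuclear*. -/
def IsNuclearMap {E F : Type*} [NormedAddCommGroup E] [NormedSpace ℝ E]
    [NormedAddCommGroup F] [NormedSpace ℝ F] (T : E →L[ℝ] F) : Prop :=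
  ∃ (φ : ℕ → E →L[ℝ] ℝ) (y : ℕ → F),
    Summable (fun n => ‖φ n‖ * ‖y n‖) ∧ ∀ x, HasSum (fun n => φ n x • y n) (T x)

/-- A locally convex space is *nuclear* if for every continuous Hilbert seminorm `p` there is a
continuous Hilbert seminorm `r ≥ p` such that the natural map `X_r → X_p` between the Banach
completions is nuclear. -/
def IsNuclearSpace (X : Type*) [AddCommGroup X] [Module ℝ X] [TopologicalSpace X] : Prop :=
  ∀ p : Seminorm ℝ X, Continuous p → IsHilbertSeminorm p →
    ∃ r : Seminorm ℝ X, Continuous r ∧ IsHilbertSeminorm r ∧ p ≤ r ∧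
      ∀ (Xr Xp : Type) [NormedAddCommGroup Xr] [NormedSpace ℝ Xr] [CompleteSpace Xr]
        [NormedAddCommGroup Xp] [NormedSpace ℝ Xp] [CompleteSpace Xp]
        (ιr : X →ₗ[ℝ] Xr) (ιp : X →ₗ[ℝ] Xp), IsBanachCompletion r ιr →
          IsBanachCompletion p ιp →
          ∀ T : Xr →L[ℝ] Xp, (∀ x, T (ιr x) = ιp x) → IsNuclearMap T

/-- A factorisation of `L : H → B` through a separable Hilbert space `J` of (Hilbert) dimension
at most that of `H`, as a Hilbert–Schmidt map followed by a continuous linear map. -/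
structure HSFactorizationLE {H B : Type} [NormedAddCommGroup H] [InnerProductSpace ℝ H]
    [NormedAddCommGroup B] [NormedSpace ℝ B] (L : H →ₗ[ℝ] B) : Type 1 where
  J : Type
  [nJ : NormedAddCommGroup J]
  [iJ : InnerProductSpace ℝ J]
  [cJ : CompleteSpace J]
  [sJ : TopologicalSpace.SeparableSpace J]
  j : H →ₗ[ℝ] J
  k : J →L[ℝ] B
  hilbertSchmidt : IsHilbertSchmidtMap j
  factorises : ∀ x, k (j x) = L x
  rank_le : Module.rank ℝ J ≤ Module.rank ℝ H

/-- An absolutely `p`-summing operator with `p ∈ [1, 2]` is absolutely `2`-summing. -/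
lemma AbsolutelySumming.exists_sum_norm_sq_le {E F : Type*} [NormedAddCommGroup E]
    [NormedSpace ℝ E] [NormedAddCommGroup F] [NormedSpace ℝ F] {p : ℝ} (hp1 : 1 ≤ p)
    (hp2 : p ≤ 2) {T : E →ₗ[ℝ] F} (hT : AbsolutelySumming p T) :
    ∃ C : ℝ, 0 < C ∧ ∀ (k : ℕ) (x : Fin k → E) (W : ℝ),
      (∀ φ : E →L[ℝ] ℝ, ‖φ‖ ≤ 1 → ∑ n, φ (x n) ^ 2 ≤ W) →
        ∑ n, ‖T (x n)‖ ^ 2 ≤ C ^ 2 * W := by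
  obtain ⟨C, hC, hT⟩ := hT
  refine ⟨C, hC, fun k x W hW => ?_⟩
  have hp : 0 < p := by linarith
  have hW0 : 0 ≤ W := by simpa using hW 0 (by simp)
  set S := ∑ n, ‖T (x n)‖ ^ 2 with hS
  have hS0 : 0 ≤ S := Finset.sum_nonneg fun _ _ => sq_nonneg _
  set R := (1 - p / 2) * S + p / 2 * (C ^ 2 * W) with hR
  have hR0 : 0 ≤ R := add_nonneg (mul_nonneg (by linarith) hS0) (by positivity)
  -- Test the definition on the rescaled vectors `‖T xₙ‖ ^ (2 / p - 1) • xₙ`.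
  let c : Fin k → ℝ := fun n => ‖T (x n)‖ ^ (2 / p - 1)
  have hc0 : ∀ n, 0 ≤ c n := fun n => Real.rpow_nonneg (norm_nonneg _) _
  have hcp : ∀ n, c n ^ p = (‖T (x n)‖ ^ 2) ^ (1 - p / 2) := fun n => by
    simp only [c]
    rw [← Real.rpow_mul (norm_nonneg _), ← Real.rpow_natCast, ← Real.rpow_mul (norm_nonneg _)]
    congr 1
    push_cast
    field_simp
  have hsum : ∑ n, ‖T (c n • x n)‖ ^ p = S := by
    refine Finset.sum_congr rfl fun n _ => ?_
    rw [map_smul, norm_smul, Real.norm_of_nonneg (hc0 n)]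
    rcases (norm_nonneg (T (x n))).eq_or_lt with h | h
    · simp [← h, hp.ne']
    · simp only [c]
      nth_rewrite 2 [← Real.rpow_one ‖T (x n)‖]
      rw [← Real.rpow_add h, ← Real.rpow_mul h.le, ← Real.rpow_natCast]
      congr 1
      push_cast
      field_simp
      ring
  have hfun : ∀ φ : {ψ : E →L[ℝ] ℝ // ‖ψ‖ ≤ 1},
      (∑ n, |φ.1 (c n • x n)| ^ p) ^ (1 / p) ≤ R ^ (1 / p) / C := by
    rintro ⟨φ, hφ⟩
    rw [le_div_iff₀ hC]
    change (∑ n, |φ (c n • x n)| ^ p) ^ (1 / p) * C ≤ R ^ (1 / p)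
    have hCp : C = (C ^ p) ^ (1 / p) := by
      rw [← Real.rpow_mul hC.le, mul_one_div_cancel hp.ne', Real.rpow_one]
    have h0 : 0 ≤ ∑ n, |φ (c n • x n)| ^ p := Finset.sum_nonneg fun _ _ => by positivity
    nth_rewrite 1 [hCp]
    rw [← Real.mul_rpow h0 (by positivity)]
    refine Real.rpow_le_rpow (by positivity) ?_ (by positivity)
    calc (∑ n, |φ (c n • x n)| ^ p) * C ^ p
        = ∑ n, (‖T (x n)‖ ^ 2) ^ (1 - p / 2) * ((C * |φ (x n)|) ^ 2) ^ (p / 2) := by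
          rw [Finset.sum_mul]
          refine Finset.sum_congr rfl fun n _ => ?_
          have h2 : ((C * |φ (x n)|) ^ 2) ^ (p / 2) = C ^ p * |φ (x n)| ^ p := by
            rw [← Real.rpow_natCast_mul (by positivity), Nat.cast_ofNat,
              mul_div_cancel₀ p two_ne_zero, Real.mul_rpow hC.le (abs_nonneg _)]
          rw [h2, ← hcp, map_smul, smul_eq_mul, abs_mul, abs_of_nonneg (hc0 n),
            Real.mul_rpow (hc0 n) (abs_nonneg _)]
          ring
      _ ≤ ∑ n, ((1 - p / 2) * ‖T (x n)‖ ^ 2 + p / 2 * (C * |φ (x n)|) ^ 2) :=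
          Finset.sum_le_sum fun n _ => Real.geom_mean_le_arith_mean2_weighted
            (by linarith) (by positivity) (by positivity) (by positivity) (by ring)
      _ = (1 - p / 2) * S + p / 2 * (C ^ 2 * ∑ n, φ (x n) ^ 2) := by
          simp only [Finset.sum_add_distrib, ← Finset.mul_sum, mul_pow, sq_abs, hS]
      _ ≤ R := by
          have := hW φ hφ
          rw [hR]
          gcongr
  have : Nonempty {ψ : E →L[ℝ] ℝ // ‖ψ‖ ≤ 1} := ⟨⟨0, by simp⟩⟩
  have key := (hT k fun n => c n • x n).trans (mul_le_mul_of_nonneg_left (ciSup_le hfun) hC.le)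
  rw [hsum, mul_div_cancel₀ _ hC.ne', Real.rpow_le_rpow_iff hS0 hR0 (by positivity)] at key
  nlinarith

/-- Domination theorem: an operator on a Hilbert space satisfying the `2`-summing inequality is
dominated by a positive semidefinite form of trace at most one. -/
lemma exists_form_dominating {H B : Type*} [NormedAddCommGroup H] [InnerProductSpace ℝ H]
    [CompleteSpace H] [NormedAddCommGroup B] [NormedSpace ℝ B] {L : H →ₗ[ℝ] B} {C : ℝ}
    (hC : 0 < C) (hL : ∀ (k : ℕ) (x : Fin k → H) (W : ℝ),
      (∀ φ : H →L[ℝ] ℝ, ‖φ‖ ≤ 1 → ∑ n, φ (x n) ^ 2 ≤ W) →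
        ∑ n, ‖L (x n)‖ ^ 2 ≤ C ^ 2 * W) :
    ∃ q : H →ₗ[ℝ] H →ₗ[ℝ] ℝ, (∀ x y, q x y = q y x) ∧ (∀ x, 0 ≤ q x x) ∧
      (∀ x, ‖L x‖ ^ 2 ≤ C ^ 2 * q x x) ∧
      ∀ {ι : Type} (s : Finset ι) (v : ι → H) (M : ℝ),
        (∀ y, ∑ i ∈ s, ⟪v i, y⟫ ^ 2 ≤ M * ‖y‖ ^ 2) → 0 ≤ M → ∑ i ∈ s, q (v i) (v i) ≤ M := by
  rcases subsingleton_or_nontrivial H with _ | _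
  · refine ⟨0, by simp, by simp, fun x => by simp [Subsingleton.elim x 0], ?_⟩
    intro ι s v M _ hM
    simpa using hM
  let K : PointedCone ℝ (H →L[ℝ] H) :=
    { carrier := {A | ∃ l : List H, ∀ y, C ^ 2 * (l.map fun x => ⟪x, y⟫ ^ 2).sum
        - (l.map fun x => ‖L x‖ ^ 2).sum * ‖y‖ ^ 2 ≤ ⟪A y, y⟫}
      add_mem' := by
        rintro A A' ⟨l, hl⟩ ⟨l', hl'⟩
        refine ⟨l ++ l', fun y => ?_⟩
        have h := hl y
        have h' := hl' y
        simp only [List.map_append, List.sum_append, add_apply, inner_add_left]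
        linarith
      zero_mem' := ⟨[], by simp⟩
      smul_mem' := by
        rintro ⟨c, hc⟩ A ⟨l, hl⟩
        refine ⟨l.map fun x => √c • x, fun y => ?_⟩
        have h := mul_le_mul_of_nonneg_left (hl y) hc
        simp only [List.map_map, Function.comp_def, map_smul, norm_smul, inner_smul_left, mul_pow,
          Real.norm_eq_abs, sq_abs, conj_trivial, Real.sq_sqrt hc, List.sum_map_mul_left]
        have hA : ⟪((⟨c, hc⟩ : {c : ℝ // 0 ≤ c}) • A) y, y⟫ = c * ⟪A y, y⟫ := by
          change ⟪c • A y, y⟫ = _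
          rw [inner_smul_left, conj_trivial]
        rw [hA]
        linarith }
  have hpos : ∀ A : H →L[ℝ] H, (∀ y, 0 ≤ ⟪A y, y⟫) → A ∈ K := fun A hA => ⟨[], by simpa using hA⟩
  let I : H →L[ℝ] H := ContinuousLinearMap.id ℝ H
  have hI : I ≠ 0 := by
    obtain ⟨y, hy⟩ := exists_ne (0 : H)
    exact fun h => hy (by simpa [I] using congrArg (fun A : H →L[ℝ] H => A y) h)
  have hone : ∀ t : ℝ, t • I ∈ K → 0 ≤ t := by
    rintro t ⟨l, hl⟩
    set S := (l.map fun x => ‖L x‖ ^ 2).sum with hS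
    have hl' : ∀ y, C ^ 2 * (l.map fun x => ⟪x, y⟫ ^ 2).sum ≤ (t + S) * ‖y‖ ^ 2 := fun y => by
      have := hl y
      simp only [I, FunLike.coe_smul, Pi.smul_apply, ContinuousLinearMap.id_apply,
        inner_smul_left, conj_trivial, real_inner_self_eq_norm_sq] at this
      linarith
    have hlist : ∀ f : H → ℝ, ∑ n : Fin l.length, f l[n] = (l.map f).sum := fun f => by
      simp
    have htS : 0 ≤ t + S := by
      obtain ⟨y, hy⟩ := exists_ne (0 : H)
      have h0 : 0 ≤ (l.map fun x => ⟪x, y⟫ ^ 2).sum := by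
        rw [← hlist]
        exact Finset.sum_nonneg fun _ _ => sq_nonneg _
      exact nonneg_of_mul_nonneg_left ((mul_nonneg (sq_nonneg C) h0).trans (hl' y))
        (pow_pos (norm_pos_iff.2 hy) 2)
    have h := hL l.length (fun n => l[n]) ((t + S) / C ^ 2) fun φ hφ => by
      obtain ⟨y, rfl⟩ := (InnerProductSpace.toDual ℝ H).surjective φ
      rw [LinearIsometryEquiv.norm_map] at hφ
      simp only [InnerProductSpace.toDual_apply_apply, real_inner_comm _ y]
      rw [hlist fun x => ⟪x, y⟫ ^ 2, le_div_iff₀ (by positivity), mul_comm]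
      exact (hl' y).trans (mul_le_of_le_one_right htS (pow_le_one₀ (norm_nonneg y) hφ))
    rw [hlist fun x => ‖L x‖ ^ 2, mul_div_cancel₀ _ (by positivity)] at h
    linarith
  obtain ⟨g, hgI, hgK⟩ := riesz_extension K (LinearPMap.mkSpanSingleton I (1 : ℝ) hI)
    (by
      rintro ⟨A, hA⟩ hAK
      obtain ⟨t, rfl⟩ := Submodule.mem_span_singleton.1 hA
      rw [LinearPMap.mkSpanSingleton'_apply]
      simpa using hone t hAK)
    (fun A => by
      refine ⟨⟨‖A‖ • I, Submodule.mem_span_singleton.2 ⟨_, rfl⟩⟩, hpos _ fun y => ?_⟩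
      have h1 := abs_le.1 (abs_real_inner_le_norm (A y) y)
      have h2 := mul_le_mul_of_nonneg_right (A.le_opNorm y) (norm_nonneg y)
      simp only [I, add_apply, FunLike.coe_smul, Pi.smul_apply,
        ContinuousLinearMap.id_apply, inner_add_left, inner_smul_left, conj_trivial,
        real_inner_self_eq_norm_sq]
      nlinarith [h1.1])
  have hg1 : g I = 1 :=
    (hgI ⟨I, Submodule.mem_span_singleton_self I⟩).trans
      (LinearPMap.mkSpanSingleton_apply ℝ ℝ hI 1)
  have hgpos : ∀ A : H →L[ℝ] H, (∀ y, 0 ≤ ⟪A y, y⟫) → 0 ≤ g A := fun A hA => hgK A (hpos A hA)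
  let r : H → H → H →L[ℝ] H := fun x y => (innerSL ℝ x).smulRight y
  have hr : ∀ x y z, r x y z = ⟪x, z⟫ • y := fun x y z => by simp [r]
  let q : H →ₗ[ℝ] H →ₗ[ℝ] ℝ := LinearMap.mk₂ ℝ (fun x y => g (r x y))
    (fun x x' y => by
      rw [← map_add]; congr 1; ext z; simp [hr, inner_add_left, add_smul])
    (fun c x y => by
      rw [← map_smul]; congr 1; ext z; simp [hr, inner_smul_left, mul_smul])
    (fun x y y' => by
      rw [← map_add]; congr 1; ext z; simp [hr])
    (fun c x y => by
      rw [← map_smul]; congr 1; ext z; simp [hr, smul_comm c])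
  have hq : ∀ x y, q x y = g (r x y) := fun x y => rfl
  refine ⟨q, fun x y => ?_, fun x => ?_, fun x => ?_, fun {ι} s v M hv _ => ?_⟩
  · have hle : ∀ x y, g (r x y) ≤ g (r y x) := fun x y => by
      have := hgpos (r y x - r x y) fun z => by
        simp [hr, inner_sub_left, inner_smul_left, mul_comm]
      rw [map_sub] at this
      linarith
    exact le_antisymm (hle x y) (hle y x)
  · exact hgpos _ fun z => by
      simpa [hr, inner_smul_left] using mul_self_nonneg _
  · have := hgK (C ^ 2 • r x x - ‖L x‖ ^ 2 • I) ⟨[x], fun y => by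
      simp [hr, I, inner_sub_left, inner_smul_left, sq]⟩
    rw [map_sub, map_smul, map_smul, hg1] at this
    simp only [smul_eq_mul, mul_one] at this
    rw [hq]
    linarith
  · have := hgpos (M • I - ∑ i ∈ s, r (v i) (v i)) fun y => by
      have := hv y
      simp only [sq (inner ℝ _ _)] at this
      simpa [hr, I, inner_sub_left, inner_smul_left, sum_inner, real_inner_self_eq_norm_sq]
        using this
    rw [map_sub, map_smul, hg1, map_sum] at this
    simp only [smul_eq_mul, mul_one] at this
    simp only [hq]
    linarith

/-- Every positive semidefinite form is the pullback of the inner product of a Hilbert space under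
a linear map with dense range. -/
lemma exists_hilbert_realization {V : Type} [AddCommGroup V] [Module ℝ V]
    (q : V →ₗ[ℝ] V →ₗ[ℝ] ℝ) (hsymm : ∀ x y, q x y = q y x) (hpos : ∀ x, 0 ≤ q x x) :
    ∃ (J : Type) (_ : NormedAddCommGroup J) (_ : InnerProductSpace ℝ J) (_ : CompleteSpace J)
      (j : V →ₗ[ℝ] J), DenseRange j ∧ ∀ x, ‖j x‖ ^ 2 = q x x := by
  let core : PreInnerProductSpace.Core ℝ V :=
    { inner := fun x y => q x y
      conj_inner_symm := fun x y => hsymm y x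
      re_inner_nonneg := hpos
      add_left := fun x y z => by simp
      smul_left := fun x y c => by simp }
  let : SeminormedAddCommGroup V :=
    @InnerProductSpace.Core.toSeminormedAddCommGroup ℝ V _ _ _ core
  let : InnerProductSpace ℝ V := InnerProductSpace.ofCore core
  refine ⟨UniformSpace.Completion V, inferInstance, inferInstance, inferInstance,
    (UniformSpace.Completion.toComplL (𝕜 := ℝ) (E := V)).toLinearMap,
    UniformSpace.Completion.denseRange_coe, fun x => ?_⟩
  have h : ‖(UniformSpace.Completion.toComplL (𝕜 := ℝ) (E := V)) x‖ = ‖x‖ :=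
    UniformSpace.Completion.norm_coe x
  exact (congrArg (· ^ 2) h).trans (real_inner_self_eq_norm_sq x).symm

/-- An orthonormal family in a separable space is countable. -/
lemma Orthonormal.countable_of_separableSpace {J ι : Type*} [NormedAddCommGroup J]
    [InnerProductSpace ℝ J] [TopologicalSpace.SeparableSpace J] {v : ι → J}
    (hv : Orthonormal ℝ v) : Countable ι := by
  refine Pairwise.countable_of_isOpen_disjoint (s := fun i => Metric.ball (v i) (1 / 2))
    (fun i i' hii' => Metric.ball_disjoint_ball ?_) (fun _ => Metric.isOpen_ball)
    (fun i => ⟨v i, Metric.mem_ball_self (by norm_num)⟩)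
  have h : ‖v i - v i'‖ ^ 2 = 2 := by
    rw [norm_sub_sq_real, hv.1, hv.1, hv.2 hii']
    norm_num
  rw [dist_eq_norm]
  nlinarith [norm_nonneg (v i - v i')]

/-- A separable Hilbert space containing a dense linear image of a Hilbert space `H` has dimension
at most that of `H`. -/
lemma rank_le_of_denseRange {H J : Type} [NormedAddCommGroup H] [InnerProductSpace ℝ H]
    [CompleteSpace H] [NormedAddCommGroup J] [InnerProductSpace ℝ J] [CompleteSpace J]
    [TopologicalSpace.SeparableSpace J] (j : H →ₗ[ℝ] J) (hj : DenseRange j) :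
    Module.rank ℝ J ≤ Module.rank ℝ H := by
  by_cases hfin : FiniteDimensional ℝ H
  · refine LinearMap.rank_le_of_surjective j (LinearMap.range_eq_top.1 ?_)
    have hclosed : IsClosed (j.range : Set J) := j.range.closed_of_finiteDimensional
    rw [← hclosed.submodule_topologicalClosure_eq]
    exact (Submodule.dense_iff_topologicalClosure_eq_top).1 (by rwa [DenseRange, ← LinearMap.coe_range] at hj)
  obtain ⟨w, b, -⟩ := exists_hilbertBasis ℝ H
  obtain ⟨w', b', -⟩ := exists_hilbertBasis ℝ J
  have : Infinite w := by
    by_contra h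
    have := not_infinite_iff_finite.1 h
    have := Fintype.ofFinite w
    exact hfin b.toOrthonormalBasis.toBasis.finiteDimensional_of_finite
  have : Countable w' := b'.orthonormal.countable_of_separableSpace
  obtain ⟨e⟩ : Nonempty (w' ↪ w) := by
    obtain ⟨f, hf⟩ := exists_injective_nat w'
    exact ⟨(⟨f, hf⟩ : w' ↪ ℕ).trans (Infinite.natEmbedding w)⟩
  have ho : Orthonormal ℝ (b ∘ e) := b.orthonormal.comp e e.injective
  let T : J →ₗᵢ[ℝ] H :=
    ho.orthogonalFamily.linearIsometry.comp b'.repr.toLinearIsometry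
  exact LinearMap.rank_le_of_injective T.toLinearMap T.injective

/-- Every absolutely `p`-summing operator `L : H → B` (`1 ≤ p ≤ 2`) from a
separable Hilbert space to a Banach space factorises through a separable Hilbert space `J` with
`dim J ≤ dim H` as a Hilbert–Schmidt map followed by a continuous linear map. -/
theorem statement_6 {H B : Type} [NormedAddCommGroup H] [InnerProductSpace ℝ H]
    [CompleteSpace H] [TopologicalSpace.SeparableSpace H]
    [NormedAddCommGroup B] [NormedSpace ℝ B] [CompleteSpace B]
    (p : ℝ) (hp1 : 1 ≤ p) (hp2 : p ≤ 2)
    (L : H →ₗ[ℝ] B) (hL : AbsolutelySumming p L) :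
    Nonempty (HSFactorizationLE L) := by
  obtain ⟨C, hC, hL2⟩ := hL.exists_sum_norm_sq_le hp1 hp2
  obtain ⟨q, hsymm, hpos, hdom, htrace⟩ := exists_form_dominating hC hL2
  obtain ⟨J, _, _, _, j, hj, hjq⟩ := exists_hilbert_realization q hsymm hpos
  have hjb : ∀ x, ‖j x‖ ≤ 1 * ‖x‖ := fun x => by
    have h := htrace {()} (fun _ => x) (‖x‖ ^ 2) (fun y => by
      rw [Finset.sum_singleton, ← mul_pow, sq_le_sq, abs_mul, abs_norm, abs_norm]
      exact abs_real_inner_le_norm x y) (sq_nonneg _)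
    rw [Finset.sum_singleton, ← hjq] at h
    rw [one_mul]
    exact le_of_sq_le_sq h (norm_nonneg x)
  have hLj : ∀ x, ‖L x‖ ≤ C * ‖j x‖ := fun x => by
    refine le_of_sq_le_sq ?_ (by positivity)
    rw [mul_pow, hjq]
    exact hdom x
  have : TopologicalSpace.SeparableSpace J :=
    hj.separableSpace (j.mkContinuous 1 hjb).continuous
  obtain ⟨w, b, -⟩ := exists_hilbertBasis ℝ H
  refine ⟨{ J := J, j := j, k := L.extendOfNorm j, hilbertSchmidt := ⟨w, b, ?_⟩,
            factorises := LinearMap.extendOfNorm_eq hj ⟨C, hLj⟩,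
            rank_le := rank_le_of_denseRange j hj }⟩
  refine summable_of_sum_le (c := 1) (fun _ => sq_nonneg _) fun s => ?_
  simp only [hjq]
  refine htrace s b 1 (fun y => ?_) zero_le_one
  simpa using b.orthonormal.sum_inner_products_le (s := s) y
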